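/- arXiv:2605.05677 — 2 statements merged into one kernel-verified Lean document; each statement's English description precedes it below -/
import Mathlib

section
/- The set {π̄_S : S a ⟨ω⟩-orbit in Δ₀ with α₀ ∉ S} is a vector-space basis of the fixed subspace E^ω. -/
open scoped RealInnerProductSpace

namespace Folding

variable {E : Type*} [NormedAddCommGroup E] [InnerProductSpace ℝ E]

/-- The coroot `α^∨ = 2α/(α,α)` of a nonzero vector `α`. -/
noncomputable def coroot (α : E) : E := (2 / ⟪α, α⟫) • α

/-- The reflection `s_α(x) = x - (α^∨, x) α`. -/
noncomputable def reflVec (α x : E) : E := x - ⟪coroot α, x⟫ • α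

/-- `Φ` is a (finite, not necessarily reduced) root system in `E`. -/
def IsRootSystem (Φ : Set E) : Prop :=
  Φ.Finite ∧ (0 : E) ∉ Φ ∧ Submodule.span ℝ Φ = ⊤ ∧
    (∀ α ∈ Φ, ∀ β ∈ Φ, reflVec α β ∈ Φ) ∧
    ∀ α ∈ Φ, ∀ β ∈ Φ, ∃ n : ℤ, ⟪coroot α, β⟫ = (n : ℝ)

/-- `Φ` is reduced: no root is half of another root. -/
def IsReducedRS (Φ : Set E) : Prop := ∀ α ∈ Φ, (2⁻¹ : ℝ) • α ∉ Φ

/-- `Φ` is irreducible: nonempty and not a disjoint union of two nonempty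
mutually orthogonal subsets. -/
def IsIrreducibleRS (Φ : Set E) : Prop :=
  Φ.Nonempty ∧
    ¬∃ Φ₁ Φ₂ : Set E, Φ₁.Nonempty ∧ Φ₂.Nonempty ∧ Φ₁ ∪ Φ₂ = Φ ∧ Disjoint Φ₁ Φ₂ ∧
      ∀ u ∈ Φ₁, ∀ v ∈ Φ₂, ⟪u, v⟫ = 0

/-- `Δ` is a basis (a set of simple roots) of the root system `Φ`:
it is a vector space basis of `E`, and every root is a linear combination of `Δ`
whose coefficients are all nonnegative integers or all nonpositive integers. -/
def IsBaseRS (Φ : Set E) (Δ : Finset E) : Prop :=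
  ↑Δ ⊆ Φ ∧ LinearIndependent ℝ (fun α : {x : E // x ∈ Δ} => (α : E)) ∧
    Submodule.span ℝ (Δ : Set E) = ⊤ ∧
    ∀ β ∈ Φ, ∃ c : E → ℤ, ((∀ α, 0 ≤ c α) ∨ (∀ α, c α ≤ 0)) ∧
      β = ∑ α ∈ Δ, (c α : ℝ) • α

/-- `ω` belongs to the Weyl group of `Φ`: it is a product of reflections in roots. -/
def InWeylGroup (Φ : Set E) (ω : E ≃ₗᵢ[ℝ] E) : Prop :=
  ∃ l : List E, (∀ α ∈ l, α ∈ Φ) ∧ ∀ x : E, ω x = l.foldr reflVec x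

/-- The average `x^ω = (1/o(ω)) Σ_{t=1}^{o(ω)} ω^t(x)`, where `o(ω)` is the order of `ω`. -/
noncomputable def avg (ω : E ≃ₗᵢ[ℝ] E) (x : E) : E :=
  (orderOf ω : ℝ)⁻¹ • ∑ t ∈ Finset.range (orderOf ω), (ω ^ (t + 1)) x

/-- The fixed-point set `E^ω`. -/
def fixedSet (ω : E ≃ₗᵢ[ℝ] E) : Set E := {x | ω x = x}

/-- The fixed-point subspace `E^ω`. -/
def fixedSubmodule (ω : E ≃ₗᵢ[ℝ] E) : Submodule ℝ E :=
  LinearMap.ker ((ω.toLinearEquiv : E →ₗ[ℝ] E) - LinearMap.id)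

/-- The folded root system `Φ_re^ω = {β^ω : β ∈ Φ, β^ω ≠ 0}`. -/
noncomputable def foldedRoots (Φ : Set E) (ω : E ≃ₗᵢ[ℝ] E) : Set E :=
  {v | v ≠ 0 ∧ ∃ β ∈ Φ, avg ω β = v}

/-- The `⟨ω⟩`-orbit `O(β) = {ω^t(β) : t ∈ ℤ}`. -/
def orbitOf (ω : E ≃ₗᵢ[ℝ] E) (β : E) : Set E := {γ | ∃ t : ℤ, (ω ^ t) β = γ}

/-- `N(β) = {γ ∈ O(β) : γ ≠ ±β, (β,γ) ≠ 0}`. -/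
def nbrOf (ω : E ≃ₗᵢ[ℝ] E) (β : E) : Set E :=
  {γ | γ ∈ orbitOf ω β ∧ γ ≠ β ∧ γ ≠ -β ∧ ⟪β, γ⟫ ≠ 0}


/-- `Δ^ω`: the averages of the simple roots whose `⟨ω⟩`-orbit avoids `α₀ = -htilde`. -/
noncomputable def simpleAvg (Δ : Finset E) (htilde : E) (ω : E ≃ₗᵢ[ℝ] E) : Set E :=
  {v | ∃ α ∈ (Δ : Set E), -htilde ∉ orbitOf ω α ∧ avg ω α = v}

/-- `π̄_S = (Σ_{α ∈ S} ϖ_α^∨)^ω` for a subset `S` of `Δ₀`. -/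
noncomputable def pibar (ω : E ≃ₗᵢ[ℝ] E) (ϖ : E → E) (S : Set E) : E :=
  avg ω (∑ᶠ γ ∈ S, ϖ γ)

end Folding


open Folding
open scoped Classical

namespace Folding

variable {E : Type*} [NormedAddCommGroup E] [InnerProductSpace ℝ E]

section Dual

variable {Δ : Finset E} {ϖ : E → E}

theorem inner_sum_smul_dual (hdual : ∀ α ∈ Δ, ∀ β ∈ Δ, ⟪α, ϖ β⟫ = if α = β then 1 else 0)
    (a : E → ℝ) {β : E} (hβ : β ∈ Δ) : ⟪∑ α ∈ Δ, a α • α, ϖ β⟫ = a β := by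
  rw [sum_inner, Finset.sum_eq_single_of_mem β hβ]
  · rw [real_inner_smul_left, hdual β hβ β hβ, if_pos rfl, mul_one]
  · intro α hα hne
    rw [real_inner_smul_left, hdual α hα β hβ, if_neg hne, mul_zero]

theorem inner_finsum_dual (hdual : ∀ α ∈ Δ, ∀ β ∈ Δ, ⟪α, ϖ β⟫ = if α = β then 1 else 0)
    {S : Set E} (hS : S ⊆ Δ) {α : E} (hα : α ∈ Δ) :
    ⟪α, ∑ᶠ γ ∈ S, ϖ γ⟫ = if α ∈ S then 1 else 0 := by
  have hfin : S.Finite := Δ.finite_toSet.subset hS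
  rw [finsum_mem_eq_finite_toFinset_sum _ hfin, inner_sum,
    Finset.sum_congr rfl fun γ hγ => hdual α hα γ (hS (hfin.mem_toFinset.1 hγ))]
  simp

theorem eq_zero_of_inner_eq_zero (hspan : Submodule.span ℝ (Δ : Set E) = ⊤) {y : E}
    (hy : ∀ α ∈ Δ, ⟪α, y⟫ = 0) : y = 0 := by
  have hle : Submodule.span ℝ (Δ : Set E) ≤ LinearMap.ker (innerₗ E y) :=
    Submodule.span_le.2 fun α hα => by
      simpa [real_inner_comm] using hy α hα
  have hmem : y ∈ LinearMap.ker (innerₗ E y) := hle (hspan ▸ Submodule.mem_top)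
  simpa using hmem

end Dual

section Highest

variable {Φ : Set E} {Δ : Finset E} {coeff : E → E → ℝ} {htilde : E} {ϖ : E → E}

theorem IsRootSystem.neg_mem (hΦ : IsRootSystem Φ) {β : E} (hβ : β ∈ Φ) : -β ∈ Φ := by
  have h0 : β ≠ 0 := fun h => hΦ.2.1 (h ▸ hβ)
  have hne : ⟪β, β⟫ ≠ 0 := inner_self_ne_zero.2 h0
  have h := hΦ.2.2.2.1 β hβ β hβ
  rw [reflVec, coroot, real_inner_smul_left, div_mul_cancel₀ _ hne, two_smul] at h
  simpa using h

theorem coeff_highest_nonneg (hΦ : IsRootSystem Φ) (hΔ : IsBaseRS Φ Δ)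
    (hcoeff : ∀ β ∈ Φ, β = ∑ α ∈ Δ, coeff β α • α) (hht : htilde ∈ Φ)
    (hhighest : ∀ β ∈ Φ, β ≠ htilde → ∑ α ∈ Δ, coeff β α < ∑ α ∈ Δ, coeff htilde α)
    (hdual : ∀ α ∈ Δ, ∀ β ∈ Δ, ⟪α, ϖ β⟫ = if α = β then 1 else 0)
    {α : E} (hα : α ∈ Δ) : 0 ≤ coeff htilde α := by
  have hcoeff_eq : ∀ β ∈ Φ, ∀ γ ∈ Δ, coeff β γ = ⟪β, ϖ γ⟫ := fun β hβ γ hγ => by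
    conv_rhs => rw [hcoeff β hβ]
    rw [inner_sum_smul_dual hdual _ hγ]
  have hneg : -htilde ∈ Φ := hΦ.neg_mem hht
  have hne : -htilde ≠ htilde := fun h => by
    have h₂ : (2 : ℝ) • htilde = 0 := by rw [two_smul, add_eq_zero_iff_neg_eq, h]
    exact hΦ.2.1 ((smul_eq_zero.1 h₂).resolve_left two_ne_zero ▸ hht)
  have hpos := hhighest _ hneg hne
  rw [Finset.sum_congr rfl fun γ hγ => show coeff (-htilde) γ = -coeff htilde γ by
      rw [hcoeff_eq _ hneg γ hγ, hcoeff_eq _ hht γ hγ, inner_neg_left],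
    Finset.sum_neg_distrib] at hpos
  obtain ⟨c, hc, hsum⟩ := hΔ.2.2.2 htilde hht
  have hcc : ∀ γ ∈ Δ, coeff htilde γ = c γ := fun γ hγ => by
    rw [hcoeff_eq _ hht γ hγ]
    conv_lhs => rw [hsum]
    exact inner_sum_smul_dual hdual (fun γ => (c γ : ℝ)) hγ
  rcases hc with hc | hc
  · rw [hcc α hα]
    exact_mod_cast hc α
  · have hle : ∑ γ ∈ Δ, coeff htilde γ ≤ 0 := Finset.sum_nonpos fun γ hγ => by
      rw [hcc γ hγ]
      exact_mod_cast hc γ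
    linarith

end Highest

section Orbit

variable {ω : E ≃ₗᵢ[ℝ] E}

theorem mem_orbitOf_self (α : E) : α ∈ orbitOf ω α := ⟨0, by simp⟩

theorem zpow_mem_orbitOf (t : ℤ) (α : E) : (ω ^ t) α ∈ orbitOf ω α := ⟨t, rfl⟩

theorem orbitOf_eq_of_mem {α β : E} (h : β ∈ orbitOf ω α) : orbitOf ω β = orbitOf ω α := by
  obtain ⟨s, rfl⟩ := h
  ext γ
  constructor
  · rintro ⟨t, rfl⟩
    exact ⟨t + s, by rw [zpow_add, LinearIsometryEquiv.coe_mul, Function.comp_apply]⟩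
  · rintro ⟨t, rfl⟩
    exact ⟨t - s, by
      rw [← Function.comp_apply (f := ⇑(ω ^ (t - s))), ← LinearIsometryEquiv.coe_mul, ← zpow_add,
        sub_add_cancel]⟩

theorem zpow_mem_of_image_eq {D : Set E} (hD : ω '' D = D) (t : ℤ) {α : E} (hα : α ∈ D) :
    (ω ^ t) α ∈ D := by
  induction t with
  | zero => simpa using hα
  | succ n ih =>
    rw [add_comm, zpow_add, zpow_one, LinearIsometryEquiv.coe_mul, Function.comp_apply]
    exact hD.subset ⟨_, ih, rfl⟩
  | pred n ih =>
    obtain ⟨β, hβ, h⟩ := hD.superset ih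
    rw [sub_eq_neg_add, zpow_add, zpow_neg_one, LinearIsometryEquiv.coe_mul, Function.comp_apply,
      ← h]
    simpa using hβ

theorem isOfFinOrder_of_image_eq {D : Set E} (hfin : D.Finite)
    (hspan : Submodule.span ℝ D = ⊤) (hD : ω '' D = D) : IsOfFinOrder ω := by
  by_contra hω
  have hinj := injective_pow_iff_not_isOfFinOrder.2 hω
  have := hfin.to_subtype
  let f : ℕ → D → D := fun n x => ⟨(ω ^ n) x, by
    simpa using zpow_mem_of_image_eq hD n x.2⟩
  obtain ⟨i, j, hij, hf⟩ := Finite.exists_ne_map_eq_of_infinite f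
  refine hij (hinj (LinearIsometryEquiv.toLinearEquiv_injective
    (LinearEquiv.toLinearMap_injective (LinearMap.ext_on hspan fun x hx => ?_))))
  exact congrArg Subtype.val (congrFun hf ⟨x, hx⟩)

theorem mem_fixedSubmodule {x : E} : x ∈ fixedSubmodule ω ↔ ω x = x := by
  simp [fixedSubmodule, sub_eq_zero]

theorem avg_mem_fixedSubmodule (z : E) : avg ω z ∈ fixedSubmodule ω := by
  rw [mem_fixedSubmodule, avg, map_smul, map_sum]
  congr 1
  have h : ∀ t : ℕ, ω ((ω ^ (t + 1)) z) = (ω ^ (t + 1 + 1)) z := fun t => by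
    rw [pow_succ' ω (t + 1), LinearIsometryEquiv.coe_mul, Function.comp_apply]
  simp only [h]
  have h₁ := Finset.sum_range_succ (fun t => (ω ^ (t + 1)) z) (orderOf ω)
  rw [Finset.sum_range_succ', pow_succ ω (orderOf ω), pow_orderOf_eq_one, one_mul, zero_add,
    pow_one] at h₁
  exact add_right_cancel h₁

theorem zpow_apply_of_mem_fixedSubmodule {y : E} (hy : y ∈ fixedSubmodule ω) (t : ℤ) :
    (ω ^ t) y = y := by
  rw [mem_fixedSubmodule] at hy
  have := zpow_mem_of_image_eq (ω := ω) (D := {y}) (by simp [hy]) t rfl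
  exact this

theorem inner_eq_of_mem_orbitOf {y : E} (hy : y ∈ fixedSubmodule ω) {α β : E}
    (h : β ∈ orbitOf ω α) : ⟪β, y⟫ = ⟪α, y⟫ := by
  obtain ⟨t, rfl⟩ := h
  conv_lhs => rw [← zpow_apply_of_mem_fixedSubmodule hy t]
  exact (ω ^ t).inner_map_map α y

theorem inner_avg_eq (hω : IsOfFinOrder ω) {α z : E} {k : ℝ}
    (h : ∀ β ∈ orbitOf ω α, ⟪β, z⟫ = k) : ⟪α, avg ω z⟫ = k := by
  have hn : (orderOf ω : ℝ) ≠ 0 := Nat.cast_ne_zero.2 hω.orderOf_pos.ne'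
  have hterm : ∀ t : ℕ, ⟪α, (ω ^ (t + 1)) z⟫ = k := fun t => by
    rw [← h _ (zpow_mem_orbitOf (-((t + 1 : ℕ) : ℤ)) α),
      ← (ω ^ (t + 1)).inner_map_map _ z, ← zpow_natCast,
      ← Function.comp_apply (f := ⇑(ω ^ ((t + 1 : ℕ) : ℤ))), ← LinearIsometryEquiv.coe_mul,
      ← zpow_add, add_neg_cancel, zpow_zero, LinearIsometryEquiv.coe_one, id]
  rw [avg, real_inner_smul_right, inner_sum, Finset.sum_congr rfl fun t _ => hterm t]
  simp [hn]

end Orbit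

section Extended

variable {Δ : Finset E} {α₀ : E} {ω : E ≃ₗᵢ[ℝ] E} {ϖ : E → E}

theorem orbitOf_subset_of_notMem (hD : ω '' (↑Δ ∪ {α₀}) = ↑Δ ∪ {α₀}) {α : E}
    (hα : α ∈ (↑Δ ∪ {α₀} : Set E)) (hα₀ : α₀ ∉ orbitOf ω α) : orbitOf ω α ⊆ Δ := by
  rintro _ ⟨t, rfl⟩
  refine (zpow_mem_of_image_eq hD t hα).resolve_right fun h => hα₀ ?_
  rw [Set.mem_singleton_iff] at h
  exact h ▸ zpow_mem_orbitOf t α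

theorem inner_pibar (hω : IsOfFinOrder ω) (hD : ω '' (↑Δ ∪ {α₀}) = ↑Δ ∪ {α₀})
    (hdual : ∀ α ∈ Δ, ∀ β ∈ Δ, ⟪α, ϖ β⟫ = if α = β then 1 else 0) {α β : E}
    (hα : α ∈ (↑Δ ∪ {α₀} : Set E)) (hα₀ : α₀ ∉ orbitOf ω α)
    (hβ : β ∈ (↑Δ ∪ {α₀} : Set E)) (hβ₀ : α₀ ∉ orbitOf ω β) :
    ⟪β, pibar ω ϖ (orbitOf ω α)⟫ = if β ∈ orbitOf ω α then 1 else 0 := by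
  refine inner_avg_eq hω fun γ hγ => ?_
  rw [inner_finsum_dual hdual (orbitOf_subset_of_notMem hD hα hα₀)
    (orbitOf_subset_of_notMem hD hβ hβ₀ hγ)]
  have hiff : γ ∈ orbitOf ω α ↔ β ∈ orbitOf ω α := by
    constructor <;> intro h
    · rw [← orbitOf_eq_of_mem h, orbitOf_eq_of_mem hγ]
      exact mem_orbitOf_self β
    · exact orbitOf_eq_of_mem h ▸ hγ
  simp only [hiff]

/-- A fixed vector orthogonal to all orbits avoiding `α₀` vanishes, since the remaining affine
simple roots all have the same inner product with it. -/
theorem eq_zero_of_fixed_of_inner_eq_zero (hspan : Submodule.span ℝ (Δ : Set E) = ⊤)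
    {m : E → ℝ} (hm : ∀ α ∈ Δ, 0 ≤ m α) (hα₀ : -α₀ = ∑ α ∈ Δ, m α • α) {y : E}
    (hy : y ∈ fixedSubmodule ω)
    (hzero : ∀ α ∈ Δ, α₀ ∉ orbitOf ω α → ⟪α, y⟫ = 0) : y = 0 := by
  have hval : ∀ α ∈ Δ, ⟪α, y⟫ = if α₀ ∈ orbitOf ω α then ⟪α₀, y⟫ else 0 := fun α hα => by
    split_ifs with h
    · exact (inner_eq_of_mem_orbitOf hy h).symm
    · exact hzero α hα h
  have hsum : -⟪α₀, y⟫ = (∑ α ∈ Δ, if α₀ ∈ orbitOf ω α then m α else 0) * ⟪α₀, y⟫ := by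
    rw [← inner_neg_left, hα₀, sum_inner, Finset.sum_mul]
    refine Finset.sum_congr rfl fun α hα => ?_
    rw [real_inner_smul_left, hval α hα]
    split_ifs <;> simp
  have hnonneg : 0 ≤ ∑ α ∈ Δ, if α₀ ∈ orbitOf ω α then m α else 0 :=
    Finset.sum_nonneg fun α hα => by
      split_ifs
      exacts [hm α hα, le_rfl]
  have hc : ⟪α₀, y⟫ = 0 := by
    have : (1 + ∑ α ∈ Δ, if α₀ ∈ orbitOf ω α then m α else 0) * ⟪α₀, y⟫ = 0 := by linarith
    exact (mul_eq_zero.1 this).resolve_left (by positivity)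
  exact eq_zero_of_inner_eq_zero hspan fun α hα => by simp [hval α hα, hc]

end Extended

end Folding

theorem pibar_basis_of_fixed_subspace
    {E : Type*} [NormedAddCommGroup E] [InnerProductSpace ℝ E] [FiniteDimensional ℝ E]
    (Φ : Set E) (Δ : Finset E) (coeff : E → E → ℝ) (htilde : E) (ω : E ≃ₗᵢ[ℝ] E)
    (hΦrs : IsRootSystem Φ) (hΦred : IsReducedRS Φ) (hΦirr : IsIrreducibleRS Φ)
    (hΔ : IsBaseRS Φ Δ)
    (hcoeff : ∀ β ∈ Φ, β = ∑ α ∈ Δ, coeff β α • α)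
    (hht : htilde ∈ Φ)
    (hhighest : ∀ β ∈ Φ, β ≠ htilde → ∑ α ∈ Δ, coeff β α < ∑ α ∈ Δ, coeff htilde α)
    (hωW : InWeylGroup Φ ω)
    (hωΔ₀ : ⇑ω '' (↑Δ ∪ {-htilde}) = ↑Δ ∪ {-htilde})
    (ϖ : E → E)
    (hϖdual : ∀ α ∈ Δ, ∀ β ∈ Δ, ⟪α, ϖ β⟫ = if α = β then 1 else 0)
    (hϖ0 : ϖ (-htilde) = 0) :
    LinearIndependent ℝ
      (fun v : {v : E | ∃ α ∈ (↑Δ ∪ {-htilde} : Set E),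
        -htilde ∉ orbitOf ω α ∧ v = pibar ω ϖ (orbitOf ω α)} => (v : E)) ∧
    Submodule.span ℝ {v : E | ∃ α ∈ (↑Δ ∪ {-htilde} : Set E),
      -htilde ∉ orbitOf ω α ∧ v = pibar ω ϖ (orbitOf ω α)} = fixedSubmodule ω := by
  have hω : IsOfFinOrder ω := by
    refine isOfFinOrder_of_image_eq (Δ.finite_toSet.union (Set.finite_singleton _)) ?_ hωΔ₀
    rw [Submodule.span_union, hΔ.2.2.1, top_sup_eq]
  have hpair {α β : E} := inner_pibar (α := α) (β := β) hω hωΔ₀ hϖdual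
  set B : Set E := {v : E | ∃ α ∈ (↑Δ ∪ {-htilde} : Set E),
    -htilde ∉ orbitOf ω α ∧ v = pibar ω ϖ (orbitOf ω α)}
  choose r hr hr₀ hrv using fun v : B => v.2
  have hdelta : ∀ v w : B, ⟪r v, (w : E)⟫ = if v = w then 1 else 0 := fun v w => by
    rw [hrv w, hpair (hr w) (hr₀ w) (hr v) (hr₀ v)]
    refine if_congr ⟨fun h => Subtype.ext ?_, fun h => h ▸ mem_orbitOf_self _⟩ rfl rfl
    rw [hrv v, hrv w, orbitOf_eq_of_mem h]
  have hli : LinearIndependent ℝ (fun v : B => (v : E)) := by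
    refine LinearIndependent.of_pairwise_dual_eq_zero_one _ (fun v => innerₗ E (r v)) ?_ ?_
    · intro v w hvw
      simp [hdelta, hvw]
    · intro v
      simp [hdelta]
  refine ⟨hli, le_antisymm (Submodule.span_le.2 ?_) fun x hx => ?_⟩
  · rintro _ ⟨α, -, -, rfl⟩
    exact avg_mem_fixedSubmodule _
  have := hli.finite
  have := Fintype.ofFinite B
  have hproj : ∑ v : B, ⟪r v, x⟫ • (v : E) ∈ Submodule.span ℝ B :=
    Submodule.sum_mem _ fun v _ => Submodule.smul_mem _ _ (Submodule.subset_span v.2)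
  have hfix : x - ∑ v : B, ⟪r v, x⟫ • (v : E) ∈ fixedSubmodule ω := by
    refine Submodule.sub_mem _ hx (Submodule.sum_mem _ fun v _ => Submodule.smul_mem _ _ ?_)
    rw [hrv v]
    exact avg_mem_fixedSubmodule _
  have hy := eq_zero_of_fixed_of_inner_eq_zero hΔ.2.2.1
    (fun α hα => coeff_highest_nonneg hΦrs hΔ hcoeff hht hhighest hϖdual hα)
    ((neg_neg htilde).trans (hcoeff htilde hht)) hfix fun β hβ hβ₀ => ?_
  · rwa [sub_eq_zero.1 hy]
  have hβ' : β ∈ (↑Δ ∪ {-htilde} : Set E) := Or.inl hβ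
  let v : B := ⟨pibar ω ϖ (orbitOf ω β), β, hβ', hβ₀, rfl⟩
  have hmem : r v ∈ orbitOf ω β := by
    by_contra h
    have h₁ := hdelta v v
    rw [show (v : E) = pibar ω ϖ (orbitOf ω β) from rfl, hpair hβ' hβ₀ (hr v) (hr₀ v)] at h₁
    simp [h] at h₁
  rw [← inner_eq_of_mem_orbitOf hfix hmem, inner_sub_right, inner_sum]
  simp [real_inner_smul_right, hdelta]
end

section
/- For every β ∈ Φ: the set N(β) has at most 2 elements; moreover β^ω ≠ 0 if and only if (−β ∉ O(β) and #N(β) ≤ 1). -/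
open scoped RealInnerProductSpace

namespace Folding

variable {E : Type*} [NormedAddCommGroup E] [InnerProductSpace ℝ E]

lemma inner_coroot_mul_inner_self {α : E} (hα : α ≠ 0) (x : E) :
    ⟪coroot α, x⟫ * ⟪α, α⟫ = 2 * ⟪α, x⟫ := by
  have h : ⟪α, α⟫ ≠ 0 := inner_self_ne_zero.2 hα
  rw [coroot, real_inner_smul_left]
  field_simp

lemma neg_mem_of_isRootSystem {Φ : Set E} (hΦ : IsRootSystem Φ) {α : E} (hα : α ∈ Φ) :
    -α ∈ Φ := by
  have hα0 : α ≠ 0 := fun h => hΦ.2.1 (h ▸ hα)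
  have h2 : ⟪coroot α, α⟫ = 2 :=
    mul_right_cancel₀ (inner_self_ne_zero.2 hα0) (inner_coroot_mul_inner_self hα0 α)
  have h := hΦ.2.2.2.1 α hα α hα
  rwa [reflVec, h2, show α - (2 : ℝ) • α = -α by module] at h

/-- Two vectors of equal length that are not equal or opposite have coroot pairing `-1`, `0` or
`1`, as soon as this pairing is an integer. -/
lemma pairing_cases {x y : E} (hx : x ≠ 0) (hxy : ⟪y, y⟫ = ⟪x, x⟫) (hne : y ≠ x) (hne' : y ≠ -x)
    {n : ℤ} (hn : ⟪coroot x, y⟫ = n) : n = -1 ∨ n = 0 ∨ n = 1 := by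
  have hq : 0 < ⟪x, x⟫ := real_inner_self_pos.2 hx
  have hp := inner_coroot_mul_inner_self hx y
  have h1 : 0 < ⟪y - x, y - x⟫ := real_inner_self_pos.2 (sub_ne_zero.2 hne)
  have h2 : 0 < ⟪y + x, y + x⟫ :=
    real_inner_self_pos.2 (fun h => hne' (eq_neg_of_add_eq_zero_left h))
  rw [real_inner_sub_sub_self, real_inner_comm x y] at h1
  rw [real_inner_add_add_self, real_inner_comm x y] at h2
  rw [hn] at hp
  have h3 : (n : ℝ) < 2 := by
    by_contra! h; nlinarith
  have h4 : (-2 : ℝ) < n := by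
    by_contra! h; nlinarith
  have h3' : n < 2 := by exact_mod_cast h3
  have h4' : -2 < n := by exact_mod_cast h4
  omega

lemma exists_height {Φ : Set E} {Δ : Finset E} (hΔ : IsBaseRS Φ Δ) :
    ∃ f : E →ₗ[ℝ] ℝ, ∀ α ∈ Δ, f α = 1 := by
  let b := Module.Basis.mk hΔ.2.1 (by
    rw [Subtype.range_coe_subtype]
    exact hΔ.2.2.1.ge)
  refine ⟨b.constr ℝ fun _ => (1 : ℝ), fun α hα => ?_⟩
  have h := b.constr_basis ℝ (fun _ => (1 : ℝ)) ⟨α, hα⟩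
  rwa [Module.Basis.mk_apply] at h

lemma height_ne_zero {Φ : Set E} {Δ : Finset E} (h0 : (0 : E) ∉ Φ) (hΔ : IsBaseRS Φ Δ)
    {f : E →ₗ[ℝ] ℝ} (hf : ∀ α ∈ Δ, f α = 1) {β : E} (hβ : β ∈ Φ) : f β ≠ 0 := by
  obtain ⟨c, hc, hβc⟩ := hΔ.2.2.2 β hβ
  intro hfβ
  have hsum : ∑ α ∈ Δ, c α = 0 := by
    have h : ∑ α ∈ Δ, (c α : ℝ) = 0 := by
      rw [← hfβ, hβc, map_sum]
      exact Finset.sum_congr rfl fun α hα => by rw [map_smul, hf α hα, smul_eq_mul, mul_one]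
    exact_mod_cast h
  have hz : ∀ α ∈ Δ, c α = 0 := by
    rcases hc with hc | hc
    · exact (Finset.sum_eq_zero_iff_of_nonneg fun α _ => hc α).1 hsum
    · exact (Finset.sum_eq_zero_iff_of_nonpos fun α _ => hc α).1 hsum
  refine h0 ?_
  rwa [hβc, Finset.sum_eq_zero fun α hα => by rw [hz α hα, Int.cast_zero, zero_smul]] at hβ

/-- If `ω` maps `Δ` into `Δ ∪ {-θ}`, it preserves the height of roots modulo `ht(θ) + 1`. -/
lemma height_apply_sub {Φ : Set E} {Δ : Finset E} (hΔ : IsBaseRS Φ Δ) {f : E →ₗ[ℝ] ℝ}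
    (hf : ∀ α ∈ Δ, f α = 1) {θ : E} {ω : E ≃ₗᵢ[ℝ] E}
    (hω : ∀ α ∈ Δ, ω α ∈ (Δ : Set E) ∪ {-θ}) {β : E} (hβ : β ∈ Φ) :
    ∃ m : ℤ, f (ω β) - f β = m * (f θ + 1) := by
  have h (α : E) : ∃ m : ℤ, α ∈ Δ → f (ω α) - f α = m * (f θ + 1) := by
    by_cases hα : α ∈ Δ
    · rcases hω α hα with h | h
      · exact ⟨0, fun _ => by rw [hf _ h, hf _ hα]; simp⟩
      · refine ⟨-1, fun _ => ?_⟩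
        rw [Set.mem_singleton_iff.1 h, hf _ hα, map_neg]
        push_cast
        ring
    · exact ⟨0, fun h => absurd h hα⟩
  choose m hm using h
  obtain ⟨c, -, hβc⟩ := hΔ.2.2.2 β hβ
  refine ⟨∑ α ∈ Δ, c α * m α, ?_⟩
  rw [hβc]
  simp only [map_sum, map_smul, smul_eq_mul, ← Finset.sum_sub_distrib, ← mul_sub]
  push_cast
  rw [Finset.sum_mul]
  exact Finset.sum_congr rfl fun α hα => by rw [hm α hα, mul_assoc]

lemma InWeylGroup.apply_mem {Φ : Set E} (hΦ : IsRootSystem Φ) {ω : E ≃ₗᵢ[ℝ] E}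
    (hω : InWeylGroup Φ ω) {β : E} (hβ : β ∈ Φ) : ω β ∈ Φ := by
  obtain ⟨l, hl, h⟩ := hω
  rw [h]
  clear h
  induction l with
  | nil => exact hβ
  | cons α l ih =>
    exact hΦ.2.2.2.1 α (hl α List.mem_cons_self) _
      (ih fun γ hγ => hl γ (List.mem_cons_of_mem _ hγ))

lemma pow_apply_mem {Φ : Set E} {ω : E ≃ₗᵢ[ℝ] E} (hω : ∀ β ∈ Φ, ω β ∈ Φ) {β : E}
    (hβ : β ∈ Φ) (k : ℕ) : (ω ^ k) β ∈ Φ := by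
  induction k with
  | zero => exact hβ
  | succ k ih => rw [pow_succ']; exact hω _ ih

lemma isOfFinOrder_of_apply_mem {Φ : Set E} (hfin : Φ.Finite)
    (hspan : Submodule.span ℝ Φ = ⊤) {ω : E ≃ₗᵢ[ℝ] E} (hω : ∀ β ∈ Φ, ω β ∈ Φ) :
    IsOfFinOrder ω := by
  have : Finite Φ := hfin
  by_contra hord
  refine not_injective_infinite_finite
    (fun (k : ℕ) (β : Φ) => (⟨(ω ^ k) β, pow_apply_mem hω β.2 k⟩ : Φ)) fun a b hab => ?_
  refine injective_pow_iff_not_isOfFinOrder.2 hord (LinearIsometryEquiv.ext fun x => ?_)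
  have h : Set.EqOn ((ω ^ a).toLinearEquiv : E →ₗ[ℝ] E) ((ω ^ b).toLinearEquiv : E →ₗ[ℝ] E) Φ :=
    fun β hβ => congrArg Subtype.val (congrFun hab ⟨β, hβ⟩)
  exact LinearMap.congr_fun (LinearMap.ext_on hspan h) x

lemma exists_pow_of_mem_orbitOf {ω : E ≃ₗᵢ[ℝ] E} (hord : IsOfFinOrder ω) {β γ : E}
    (hγ : γ ∈ orbitOf ω β) : ∃ k : ℕ, (ω ^ k) β = γ := by
  obtain ⟨t, ht⟩ := hγ
  obtain ⟨k, hk⟩ := hord.mem_powers_iff_mem_zpowers.2 ⟨t, rfl⟩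
  exact ⟨k, by rw [← ht]; exact congrArg (fun g : E ≃ₗᵢ[ℝ] E => g β) hk⟩

lemma self_mem_orbitOf (ω : E ≃ₗᵢ[ℝ] E) (β : E) : β ∈ orbitOf ω β := ⟨0, rfl⟩

lemma zpow_apply_mem_orbitOf {ω : E ≃ₗᵢ[ℝ] E} {β γ : E} (hγ : γ ∈ orbitOf ω β) (t : ℤ) :
    (ω ^ t) γ ∈ orbitOf ω β := by
  obtain ⟨s, rfl⟩ := hγ
  exact ⟨t + s, by rw [zpow_add]; rfl⟩

lemma avg_apply {ω : E ≃ₗᵢ[ℝ] E} (x : E) : avg ω (ω x) = avg ω x := by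
  have h (t : ℕ) : (ω ^ (t + 1)) (ω x) = (ω ^ (t + 1 + 1)) x := by rw [pow_succ ω (t + 1)]; rfl
  have h' := Finset.sum_range_succ' (fun t => (ω ^ (t + 1)) x) (orderOf ω)
  rw [Finset.sum_range_succ, pow_succ, pow_orderOf_eq_one, zero_add, pow_one, one_mul] at h'
  simp only [avg, h, ← add_right_cancel h']

lemma avg_pow_apply {ω : E ≃ₗᵢ[ℝ] E} (k : ℕ) (x : E) : avg ω ((ω ^ k) x) = avg ω x := by
  induction k with
  | zero => rfl
  | succ k ih => rw [← ih, ← avg_apply ((ω ^ k) x), pow_succ']; rfl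

lemma avg_sum {ι : Type*} (ω : E ≃ₗᵢ[ℝ] E) (s : Finset ι) (x : ι → E) :
    avg ω (∑ i ∈ s, x i) = ∑ i ∈ s, avg ω (x i) := by
  simp only [avg, map_sum, ← Finset.smul_sum]
  rw [Finset.sum_comm]

lemma avg_of_apply_eq {ω : E ≃ₗᵢ[ℝ] E} (hord : IsOfFinOrder ω) {x : E} (hx : ω x = x) :
    avg ω x = x := by
  have h (k : ℕ) : (ω ^ k) x = x := by
    induction k with
    | zero => rfl
    | succ k ih => rw [pow_succ]; exact (congrArg _ hx).trans ih
  have hn : (orderOf ω : ℝ) ≠ 0 := Nat.cast_ne_zero.2 hord.orderOf_pos.ne'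
  simp only [avg, h, Finset.sum_const, Finset.card_range]
  rw [← Nat.cast_smul_eq_nsmul ℝ, inv_smul_smul₀ hn]

section OrbitSum

variable {ω : E ≃ₗᵢ[ℝ] E} {β : E} {P : Finset E}

lemma zpow_apply_orbit_sum (hP : (P : Set E) = orbitOf ω β) (t : ℤ) :
    (ω ^ t) (∑ γ ∈ P, γ) = ∑ γ ∈ P, γ := by
  have hmem {γ : E} : γ ∈ P ↔ γ ∈ orbitOf ω β := by rw [← hP, Finset.mem_coe]
  rw [map_sum]
  refine Finset.sum_bij (fun γ _ => (ω ^ t) γ)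
    (fun γ hγ => hmem.2 (zpow_apply_mem_orbitOf (hmem.1 hγ) t))
    (fun _ _ _ _ h => (ω ^ t).injective h)
    (fun γ hγ => ⟨(ω ^ (-t)) γ, hmem.2 (zpow_apply_mem_orbitOf (hmem.1 hγ) _), ?_⟩)
    (fun _ _ => rfl)
  rw [zpow_neg]
  exact (ω ^ t).apply_symm_apply γ

lemma inner_orbit_sum_self (hP : (P : Set E) = orbitOf ω β) :
    ⟪∑ γ ∈ P, γ, ∑ γ ∈ P, γ⟫ = P.card * ⟪β, ∑ γ ∈ P, γ⟫ := by
  rw [sum_inner, ← nsmul_eq_mul, ← Finset.sum_const]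
  refine Finset.sum_congr rfl fun γ hγ => ?_
  obtain ⟨t, rfl⟩ : γ ∈ orbitOf ω β := by rw [← hP]; exact hγ
  conv_lhs => rw [← zpow_apply_orbit_sum hP t]
  exact (ω ^ t).inner_map_map _ _

lemma card_smul_avg (hP : (P : Set E) = orbitOf ω β) (hord : IsOfFinOrder ω) :
    (P.card : ℝ) • avg ω β = ∑ γ ∈ P, γ := by
  have hT := zpow_apply_orbit_sum hP 1
  rw [zpow_one] at hT
  rw [← avg_of_apply_eq hord hT, avg_sum, Nat.cast_smul_eq_nsmul, ← Finset.sum_const]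
  refine Finset.sum_congr rfl fun γ hγ => ?_
  obtain ⟨k, rfl⟩ := exists_pow_of_mem_orbitOf hord (show γ ∈ orbitOf ω β by rw [← hP]; exact hγ)
  exact (avg_pow_apply k β).symm

lemma avg_ne_zero_iff_inner_orbit_sum_pos (hP : (P : Set E) = orbitOf ω β) (hord : IsOfFinOrder ω) :
    avg ω β ≠ 0 ↔ 0 < ⟪β, ∑ γ ∈ P, γ⟫ := by
  have hcard : 0 < (P.card : ℝ) := by
    have h : β ∈ P := by rw [← Finset.mem_coe, hP]; exact self_mem_orbitOf ω β
    exact_mod_cast Finset.card_pos.2 ⟨β, h⟩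
  rw [← mul_pos_iff_of_pos_left hcard, ← inner_orbit_sum_self hP, real_inner_self_pos,
    ← card_smul_avg hP hord, smul_ne_zero_iff]
  exact ⟨fun h => ⟨hcard.ne', h⟩, fun h => h.2⟩

open Classical in
/-- If `β` has coroot pairing `-1` with all its neighbours, the pairing of `β` with its orbit sum
counts them. -/
lemma two_mul_inner_orbit_sum (hP : (P : Set E) = orbitOf ω β) (hβ : β ≠ 0)
    (hneg : ∀ γ ∈ nbrOf ω β, ⟪coroot β, γ⟫ = -1) :
    2 * ⟪β, ∑ γ ∈ P, γ⟫ =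
      (2 - (if -β ∈ orbitOf ω β then 2 else 0) - (nbrOf ω β).ncard) * ⟪β, β⟫ := by
  have hmem {γ : E} : γ ∈ P ↔ γ ∈ orbitOf ω β := by rw [← hP, Finset.mem_coe]
  have : IsAddTorsionFree E := .of_isTorsionFree ℝ E
  have hne : β ≠ -β := fun h => hβ (self_eq_neg.1 h)
  have hββ : ⟪coroot β, β⟫ = 2 :=
    mul_right_cancel₀ (inner_self_ne_zero.2 hβ) (inner_coroot_mul_inner_self hβ β)
  have hN : nbrOf ω β = (P.filter (· ∈ nbrOf ω β) : Finset E) := by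
    ext γ
    simp only [Finset.coe_filter, Set.mem_ofPred_eq, hmem]
    exact ⟨fun h => ⟨h.1, h⟩, fun h => h.2⟩
  have hterm : ∀ γ ∈ P, ⟪coroot β, γ⟫ = (if γ = β then (2 : ℝ) else 0)
      - (if γ = -β then 2 else 0) - (if γ ∈ nbrOf ω β then 1 else 0) := by
    intro γ hγ
    by_cases h1 : γ = β
    · have h2 : β ∉ nbrOf ω β := fun h => h.2.1 rfl
      rw [h1, if_pos rfl, if_neg hne, if_neg h2, hββ]
      norm_num
    by_cases h2 : γ = -β
    · have h3 : -β ∉ nbrOf ω β := fun h => h.2.2.1 rfl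
      rw [h2, if_neg hne.symm, if_pos rfl, if_neg h3, inner_neg_right, hββ]
      norm_num
    rw [if_neg h1, if_neg h2]
    split_ifs with h3
    · rw [hneg γ h3]; norm_num
    · have h4 : ⟪β, γ⟫ = 0 := by
        by_contra h
        exact h3 ⟨hmem.1 hγ, h1, h2, h⟩
      rw [coroot, real_inner_smul_left, h4]
      norm_num
  have hcard : ((nbrOf ω β).ncard : ℝ) = ∑ γ ∈ P, if γ ∈ nbrOf ω β then (1 : ℝ) else 0 := by
    conv_lhs => rw [hN, Set.ncard_coe_finset]
    rw [Finset.sum_boole]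
  rw [← inner_coroot_mul_inner_self hβ, inner_sum, Finset.sum_congr rfl hterm,
    Finset.sum_sub_distrib, Finset.sum_sub_distrib, ← hcard, Finset.sum_ite_eq',
    Finset.sum_ite_eq', if_pos (hmem.2 (self_mem_orbitOf ω β))]
  simp only [hmem]

end OrbitSum

/-- Roots in a common `⟨ω⟩`-orbit never have positive pairing, unless they are equal: otherwise
their difference would be a root whose height is a multiple of `ht(θ) + 1`. -/
lemma inner_coroot_eq_neg_one_of_mem_nbrOf {Φ : Set E} {Δ : Finset E} (hΦ : IsRootSystem Φ)
    (hΔ : IsBaseRS Φ Δ) {f : E →ₗ[ℝ] ℝ} (hf : ∀ α ∈ Δ, f α = 1) {θ : E}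
    (hθ : ∀ β ∈ Φ, f β ≤ f θ) {ω : E ≃ₗᵢ[ℝ] E} (hω : ∀ β ∈ Φ, ω β ∈ Φ)
    (hord : IsOfFinOrder ω) (hωΔ : ∀ α ∈ Δ, ω α ∈ (Δ : Set E) ∪ {-θ})
    {β γ : E} (hβ : β ∈ Φ) (hγ : γ ∈ nbrOf ω β) : ⟪coroot β, γ⟫ = -1 := by
  obtain ⟨hγO, hne, hne', hinner⟩ := hγ
  obtain ⟨k, rfl⟩ := exists_pow_of_mem_orbitOf hord hγO
  have hβ0 : β ≠ 0 := fun h => hΦ.2.1 (h ▸ hβ)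
  have hγΦ := pow_apply_mem hω hβ k
  obtain ⟨n, hn⟩ := hΦ.2.2.2.2 β hβ _ hγΦ
  have hheight : ∃ m : ℤ, f ((ω ^ k) β) - f β = m * (f θ + 1) := by
    clear hγO hne hne' hinner hγΦ hn
    induction k with
    | zero => exact ⟨0, by simp⟩
    | succ k ih =>
      obtain ⟨m, hm⟩ := ih
      obtain ⟨m', hm'⟩ := height_apply_sub hΔ hf hωΔ (pow_apply_mem hω hβ k)
      refine ⟨m' + m, ?_⟩
      rw [pow_succ']
      change f (ω ((ω ^ k) β)) - f β = _
      push_cast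
      linarith
  rcases pairing_cases hβ0 ((ω ^ k).inner_map_map β β) hne hne' hn with rfl | rfl | rfl
  · rw [hn]; norm_num
  · refine absurd ?_ hinner
    have h := inner_coroot_mul_inner_self hβ0 ((ω ^ k) β)
    rw [hn] at h
    simpa using h.symm
  · exfalso
    have hδ : (ω ^ k) β - β ∈ Φ := by
      have h := hΦ.2.2.2.1 β hβ _ hγΦ
      rwa [reflVec, hn, Int.cast_one, one_smul] at h
    obtain ⟨m, hm⟩ := hheight
    rw [← map_sub] at hm
    have h1 := hθ _ hδ
    have h2 := hθ _ (neg_mem_of_isRootSystem hΦ hδ)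
    have h3 := height_ne_zero hΦ.2.1 hΔ hf hδ
    rw [map_neg] at h2
    rw [hm] at h1 h2 h3
    have hm1 : (m : ℝ) < 1 := by
      by_contra! h; nlinarith
    have hm2 : (-1 : ℝ) < m := by
      by_contra! h; nlinarith
    have hm1' : m < 1 := by exact_mod_cast hm1
    have hm2' : -1 < m := by exact_mod_cast hm2
    obtain rfl : m = 0 := by omega
    simp at h3

end Folding

open Folding

theorem nbr_card_le_two_and_nonzero_iff
    {E : Type*} [NormedAddCommGroup E] [InnerProductSpace ℝ E] [FiniteDimensional ℝ E]
    (Φ : Set E) (Δ : Finset E) (coeff : E → E → ℝ) (htilde : E) (ω : E ≃ₗᵢ[ℝ] E)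
    (hΦrs : IsRootSystem Φ) (hΦred : IsReducedRS Φ) (hΦirr : IsIrreducibleRS Φ)
    (hΔ : IsBaseRS Φ Δ)
    (hcoeff : ∀ β ∈ Φ, β = ∑ α ∈ Δ, coeff β α • α)
    (hht : htilde ∈ Φ)
    (hhighest : ∀ β ∈ Φ, β ≠ htilde → ∑ α ∈ Δ, coeff β α < ∑ α ∈ Δ, coeff htilde α)
    (hωW : InWeylGroup Φ ω)
    (hωΔ₀ : ⇑ω '' (↑Δ ∪ {-htilde}) = ↑Δ ∪ {-htilde}) :
    ∀ β ∈ Φ, (nbrOf ω β).ncard ≤ 2 ∧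
      (avg ω β ≠ 0 ↔ (-β ∉ orbitOf ω β ∧ (nbrOf ω β).ncard ≤ 1)) := by
  classical
  intro β hβ
  obtain ⟨f, hf⟩ := exists_height hΔ
  have hθ : ∀ γ ∈ Φ, f γ ≤ f htilde := by
    have hsum : ∀ γ ∈ Φ, f γ = ∑ α ∈ Δ, coeff γ α := by
      intro γ hγ
      conv_lhs => rw [hcoeff γ hγ, map_sum]
      exact Finset.sum_congr rfl fun α hα => by rw [map_smul, hf α hα, smul_eq_mul, mul_one]
    intro γ hγ
    by_cases h : γ = htilde
    · rw [h]
    · rw [hsum γ hγ, hsum _ hht]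
      exact (hhighest γ hγ h).le
  have hω : ∀ γ ∈ Φ, ω γ ∈ Φ := fun γ hγ => hωW.apply_mem hΦrs hγ
  have hord := isOfFinOrder_of_apply_mem hΦrs.1 hΦrs.2.2.1 hω
  have hωΔ : ∀ α ∈ Δ, ω α ∈ (Δ : Set E) ∪ {-htilde} := fun α hα =>
    hωΔ₀ ▸ Set.mem_image_of_mem ω (Or.inl hα)
  have hfin : (orbitOf ω β).Finite := hΦrs.1.subset fun γ hγ => by
    obtain ⟨k, rfl⟩ := exists_pow_of_mem_orbitOf hord hγ
    exact pow_apply_mem hω hβ k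
  have hP := hfin.coe_toFinset
  have hβ0 : β ≠ 0 := fun h => hΦrs.2.1 (h ▸ hβ)
  have hq : 0 < ⟪β, β⟫ := real_inner_self_pos.2 hβ0
  have hkey := two_mul_inner_orbit_sum hP hβ0 fun γ hγ =>
    inner_coroot_eq_neg_one_of_mem_nbrOf hΦrs hΔ hf hθ hω hord hωΔ hβ hγ
  have hnonneg : 0 ≤ ⟪β, ∑ γ ∈ hfin.toFinset, γ⟫ := by
    by_contra! h
    have h0 := (avg_ne_zero_iff_inner_orbit_sum_pos hP hord).not.2 h.le.not_gt
    rw [not_not] at h0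
    rw [← card_smul_avg hP hord, h0, smul_zero, inner_zero_right] at h
    exact h.false
  rw [avg_ne_zero_iff_inner_orbit_sum_pos hP hord]
  set N := (nbrOf ω β).ncard
  have hnn : 0 ≤ (2 - (if -β ∈ orbitOf ω β then 2 else 0) - N : ℝ) :=
    nonneg_of_mul_nonneg_left (hkey ▸ mul_nonneg zero_le_two hnonneg) hq
  have hpos : 0 < ⟪β, ∑ γ ∈ hfin.toFinset, γ⟫ ↔
      0 < (2 - (if -β ∈ orbitOf ω β then 2 else 0) - N : ℝ) := by
    rw [← mul_pos_iff_of_pos_left (two_pos (α := ℝ)), hkey, mul_pos_iff_of_pos_right hq]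
  rw [hpos]
  have hN0 : (0 : ℝ) ≤ N := N.cast_nonneg
  split_ifs at hnn ⊢ with h
  · refine ⟨?_, fun h' => absurd h' (by linarith), fun h' => absurd h h'.1⟩
    have h2 : (N : ℝ) ≤ 2 := by linarith
    exact_mod_cast h2
  · have h2 : (N : ℝ) ≤ 2 := by linarith
    refine ⟨by exact_mod_cast h2, fun h' => ⟨h, ?_⟩, fun h' => ?_⟩
    · have h3 : (N : ℝ) < 2 := by linarith
      have h3' : N < 2 := by exact_mod_cast h3
      omega
    · have h3 : (N : ℝ) ≤ 1 := by exact_mod_cast h'.2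
      linarith
end
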